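/- Let p and q be odd primes, let ε = 1 or ε = −1, and let x, y be positive integers with x^p − y^q = ε. Then: (a) there exist positive integers b, c with gcd(b, c) = 1 and q not dividing c such that x = q·b·c, y + ε = q^{p−1}·b^p, and y^q + ε = q·c^p·(y + ε); (b) there exist positive integers u, v with gcd(u, v) = 1 and p not dividing v such that y = p·u·v, x − ε = p^{q−1}·u^q, and x^p − ε = p·v^q·(x − ε). -/

import Mathlib

theorem cas_expand (ε d : ℤ) (h : ε ^ 2 = 1) (n : ℕ) :
    ∃ w : ℤ, (d + ε) ^ (2 * n + 1) = ε + (2 * n + 1) * d + n * (2 * n + 1) * ε * d ^ 2 + d ^ 3 * w := by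
  induction n with
  | zero => exact ⟨0, by simp; ring⟩
  | succ n ih =>
    obtain ⟨w, hw⟩ := ih
    have e : (d + ε) ^ (2 * (n + 1) + 1) = (d + ε) ^ (2 * n + 1) * (d ^ 2 + 2 * d * ε + 1) := by
      rw [← h]; ring
    rw [e, hw]
    refine ⟨w * (d ^ 2 + 2 * d * ε + 1) + (2 * n + 1) + n * (2 * n + 1) * ε * d
      + n * (2 * n + 1) * 2, ?_⟩
    push_cast
    linear_combination (2 * d + 2*n*(2*n+1) * d^3) * h

theorem cas_S (p : ℕ) (hpodd : Odd p) (ε x : ℤ) (hε : ε = 1 ∨ ε = -1) :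
    ∃ S r w : ℤ, x ^ p - ε = S * (x - ε) ∧ S = p + (x - ε) * (p * r + (x - ε) * w) := by
  obtain ⟨n, rfl⟩ := hpodd
  obtain ⟨w, hw⟩ := cas_expand ε (x - ε) (by rcases hε with rfl | rfl <;> norm_num) n
  refine ⟨_, n * ε, w, ?_, rfl⟩
  rw [sub_add_cancel] at hw
  rw [hw]; push_cast; ring

theorem cas_pow_ineq (p q : ℕ) (hp : 0 < p) (hpq : p ≤ q) (u : ℝ) (hu : 0 ≤ u) :
    (u ^ q + 1) ^ p ≤ (u ^ p + 1) ^ q := by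
  lift u to NNReal using hu
  have h := NNReal.rpow_add_rpow_le u 1 (p := p) (q := q) (by exact_mod_cast hp) (by exact_mod_cast hpq)
  have h2 := pow_le_pow_left₀ (by positivity) h (p * q)
  have hq : 0 < q := by omega
  have e1 : ∀ z : NNReal, (z ^ (1 / (q:ℝ))) ^ (p * q) = z ^ p := by
    intro z
    rw [mul_comm, pow_mul, ← NNReal.rpow_natCast (z ^ (1 / (q:ℝ))) q, ← NNReal.rpow_mul]
    rw [one_div_mul_cancel (by positivity), NNReal.rpow_one]
  have e2 : ∀ z : NNReal, (z ^ (1 / (p:ℝ))) ^ (p * q) = z ^ q := by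
    intro z
    rw [pow_mul, ← NNReal.rpow_natCast (z ^ (1 / (p:ℝ))) p, ← NNReal.rpow_mul]
    rw [one_div_mul_cancel (by positivity), NNReal.rpow_one]
  rw [e1, e2] at h2
  simp only [NNReal.rpow_natCast, one_pow] at h2
  exact_mod_cast h2

theorem cas_pow_ineq2 (p q : ℕ) (hp : 0 < p) (hpq : p ≤ q) (A : ℝ) (hu : 1 ≤ A) :
    (A ^ p - 1) ^ q ≤ (A ^ q - 1) ^ p := by
  have hq : 0 < q := by omega
  have hA : 0 ≤ A ^ q - 1 := by linarith [one_le_pow₀ hu (n := q)]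
  have hA' : 0 ≤ A ^ p - 1 := by linarith [one_le_pow₀ hu (n := p)]
  obtain ⟨C, hC0, hC⟩ : ∃ C : ℝ, 0 ≤ C ∧ C ^ q = A ^ q - 1 :=
    ⟨(A ^ q - 1) ^ (1 / (q:ℝ)), by positivity, by
      rw [← Real.rpow_natCast, ← Real.rpow_mul hA, one_div_mul_cancel (by positivity), Real.rpow_one]⟩
  have h := cas_pow_ineq p q hp hpq C hC0
  rw [hC, sub_add_cancel, ← pow_mul, mul_comm, pow_mul] at h
  have h2 := le_of_pow_le_pow_left₀ hq.ne' (by positivity) h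
  rw [← hC, ← pow_mul, mul_comm, pow_mul]
  exact pow_le_pow_left₀ hA' (by linarith) q

theorem cas_strict (z : ℤ) (hz : 0 < z) (p : ℕ) (hp : 2 ≤ p) : z ^ p + 1 < (z + 1) ^ p := by
  induction p, hp using Nat.le_induction with
  | base => nlinarith
  | succ n hn ih =>
    have : 0 < z ^ n := by positivity
    rw [pow_succ, pow_succ]; nlinarith

theorem cas_easy (p q : ℕ) (hp : 2 ≤ p) (hpq : p ≤ q) (ε : ℤ) (hε : ε = 1 ∨ ε = -1)
    (x y a : ℤ) (hx : 0 < x) (hy : 0 < y) (h : x ^ p - y ^ q = ε) (ha : 0 < a)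
    (hxa : x - ε = a ^ q) : False := by
  have hq : q ≠ 0 := by omega
  rcases hε with rfl | rfl
  · have hx' : x = a ^ q + 1 := by linarith
    have h1 := cas_strict (a ^ q) (by positivity) p hp
    rw [← hx'] at h1
    have h2 : (a ^ p) ^ q < y ^ q := by
      rw [← pow_mul, mul_comm, pow_mul]; linarith
    have h2 := lt_of_pow_lt_pow_left₀ q (by positivity) h2
    have h3 := cas_pow_ineq p q (by omega) hpq a (by positivity)
    have h3 : (a ^ q + 1) ^ p ≤ (a ^ p + 1) ^ q := by exact_mod_cast h3
    rw [← hx'] at h3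
    have h4 : y ^ q < (a ^ p + 1) ^ q := by linarith
    have h4 := lt_of_pow_lt_pow_left₀ q (by positivity) h4
    linarith
  · have hx' : x = a ^ q - 1 := by linarith
    have h1 := cas_strict x hx p hp
    have h1 : y ^ q < (a ^ p) ^ q := by
      rw [← pow_mul, mul_comm, pow_mul, ← hxa]; rw [sub_neg_eq_add]; linarith
    have h2 := lt_of_pow_lt_pow_left₀ q (by positivity) h1
    have h3 := cas_pow_ineq2 p q (by omega) hpq a (by exact_mod_cast ha)
    have h3 : (a ^ p - 1) ^ q ≤ (a ^ q - 1) ^ p := by exact_mod_cast h3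
    rw [← hx'] at h3
    have h4 : (a ^ p - 1) ^ q < y ^ q := by linarith
    have h4 := lt_of_pow_lt_pow_left₀ q (by positivity) h4
    linarith

theorem cas_dpos (p q : ℕ) (hp : p ≠ 0) (hq : q ≠ 0) (ε : ℤ) (hε : ε = 1 ∨ ε = -1)
    (x y : ℤ) (hx : 0 < x) (hy : 0 < y) (h : x ^ p - y ^ q = ε) : 0 < x - ε := by
  rcases hε with rfl | rfl
  · rcases (show x = 1 ∨ 1 < x by omega) with rfl | h1
    · have : 0 < y ^ q := by positivity
      simp at h; omega
    · linarith
  · linarith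

theorem cas_root (p q : ℕ) (hp : p.Prime) (hq : q.Prime)
    (hpodd : Odd p) (hqodd : Odd q) (ε : ℤ) (hε : ε = 1 ∨ ε = -1)
    (x y : ℤ) (hx : 0 < x) (hy : 0 < y) (h : x ^ p - y ^ q = ε) (hpy : ¬ (p : ℤ) ∣ y) :
    ∃ a : ℤ, 0 < a ∧ x - ε = a ^ q := by
  have hd := cas_dpos p q hp.ne_zero hq.ne_zero ε hε x y hx hy h
  obtain ⟨S, r, w, hS, hS2⟩ := cas_S p hpodd ε x hε
  have hyq : (x - ε) * S = y ^ q := by linarith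
  have hpp : Prime (p : ℤ) := Nat.prime_iff_prime_int.mp hp
  have hpd : IsCoprime (p : ℤ) (x - ε) := by
    rw [Prime.coprime_iff_not_dvd hpp]
    intro hdvd
    exact hpy (hpp.dvd_of_dvd_pow (hyq ▸ Dvd.dvd.mul_right hdvd S))
  have hco : IsCoprime (x - ε) S := by
    rw [hS2]
    exact (IsCoprime.add_mul_left_left hpd _).symm
  obtain ⟨a, ha⟩ := (Int.eq_pow_of_mul_eq_pow_odd hco hqodd hyq).1
  exact ⟨a, by rw [ha] at hd; exact (hqodd.pow_pos_iff).1 hd, ha⟩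

theorem cas_struct (p q : ℕ) (hp : p.Prime) (hq : q.Prime)
    (hpodd : Odd p) (hqodd : Odd q) (ε : ℤ) (hε : ε = 1 ∨ ε = -1)
    (x y : ℤ) (hx : 0 < x) (hy : 0 < y) (h : x ^ p - y ^ q = ε) (hpy : (p : ℤ) ∣ y) :
    ∃ u v : ℤ, 0 < u ∧ 0 < v ∧ IsCoprime u v ∧ ¬ (p : ℤ) ∣ v ∧
      y = p * u * v ∧ x - ε = (p : ℤ) ^ (q - 1) * u ^ q ∧
      x ^ p - ε = p * v ^ q * (x - ε) := by
  have hd := cas_dpos p q hp.ne_zero hq.ne_zero ε hε x y hx hy h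
  obtain ⟨S, r, w, hS, hS2⟩ := cas_S p hpodd ε x hε
  have hyq : (x - ε) * S = y ^ q := by linarith
  have hpp : Prime (p : ℤ) := Nat.prime_iff_prime_int.mp hp
  have hp0 : (p : ℤ) ≠ 0 := hpp.ne_zero
  have hpd : (p : ℤ) ∣ x - ε := by
    have h1 : (p : ℤ) ∣ x ^ p - x := by
      haveI := Fact.mk hp
      rw [← ZMod.intCast_zmod_eq_zero_iff_dvd]
      simp
    have h2 : (p : ℤ) ∣ x ^ p - ε := by
      rw [show x ^ p - ε = y ^ q by linarith]
      exact dvd_pow hpy hq.ne_zero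
    have := dvd_sub h2 h1
    rwa [show x ^ p - ε - (x ^ p - x) = x - ε by ring] at this
  obtain ⟨k, hk⟩ := hpd
  obtain ⟨z, hz⟩ := hpy
  -- S = p * T
  obtain ⟨T, hT, hT2⟩ : ∃ T : ℤ, S = p * T ∧ T = 1 + (x - ε) * (r + k * w) := by
    refine ⟨_, ?_, rfl⟩
    rw [hS2, hk]; ring
  have hcoT : IsCoprime (x - ε) T := by
    rw [hT2]; exact (IsCoprime.add_mul_left_left isCoprime_one_left _).symm
  have hcopT : IsCoprime (p : ℤ) T := hcoT.of_isCoprime_of_dvd_left ⟨k, hk⟩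
  have hmul : (x - ε) * T = (p : ℤ) ^ (q - 1) * z ^ q := by
    have : (p : ℤ) * ((x - ε) * T) = p * ((p : ℤ) ^ (q - 1) * z ^ q) := by
      rw [← mul_assoc (p : ℤ) (_ ^ _), mul_pow_sub_one hq.ne_zero, ← mul_pow, ← hz, ← hyq, hT]; ring
    exact mul_left_cancel₀ hp0 this
  obtain ⟨s, hs⟩ : (p : ℤ) ^ (q - 1) ∣ x - ε := by
    apply (IsCoprime.pow_left hcopT).dvd_of_dvd_mul_right
    exact ⟨_, hmul⟩
  have hsT : s * T = z ^ q := by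
    have : (p : ℤ) ^ (q - 1) * (s * T) = (p : ℤ) ^ (q - 1) * z ^ q := by
      rw [← hmul, hs]; ring
    exact mul_left_cancel₀ (pow_ne_zero _ hp0) this
  have hcos : IsCoprime s T := hcoT.of_isCoprime_of_dvd_left ⟨_, by rw [hs, mul_comm]⟩
  obtain ⟨⟨u, hu⟩, ⟨v, hv⟩⟩ := Int.eq_pow_of_mul_eq_pow_odd hcos hqodd hsT
  have hppos : (0 : ℤ) < p := by exact_mod_cast hp.pos
  have hzuv : z = u * v := by
    rw [hu, hv, ← mul_pow] at hsT
    exact (hqodd.strictMono_pow.injective hsT).symm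
  have hs0 : 0 < s := by
    rw [hs] at hd; exact (pos_iff_pos_of_mul_pos hd).1 (by positivity)
  have hu0 : 0 < u := by rw [hu] at hs0; exact (hqodd.pow_pos_iff).1 hs0
  have hz0 : 0 < z := by rw [hz] at hy; exact (pos_iff_pos_of_mul_pos hy).1 hppos
  have hv0 : 0 < v := by rw [hzuv] at hz0; exact (pos_iff_pos_of_mul_pos hz0).1 hu0
  refine ⟨u, v, hu0, hv0, ?_, ?_, ?_, ?_, ?_⟩
  · rw [hu, hv] at hcos
    exact (IsCoprime.pow_iff hq.pos hq.pos).1 hcos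
  · intro hdv
    rw [hv] at hcopT
    exact (Prime.coprime_iff_not_dvd hpp).1 hcopT (dvd_pow hdv hq.ne_zero)
  · rw [hz, hzuv]; ring
  · rw [hs, hu]
  · rw [hS, hT, hv]

theorem cas_modone (p q : ℕ) (hp : p.Prime) (hq : q.Prime) (hqp : q < p) (n : ℕ)
    (c : ℤ) (hc : (q : ℤ) ^ n ∣ c ^ p - 1) : (q : ℤ) ^ n ∣ c - 1 := by
  have h1 : ((c : ZMod (q ^ n)) ^ p) = 1 := by
    have := (ZMod.intCast_zmod_eq_zero_iff_dvd (c ^ p - 1) (q ^ n)).2 (by exact_mod_cast hc)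
    push_cast at this
    linear_combination this
  have h2 : (c : ZMod (q ^ n)) = 1 := by
    haveI : NeZero (q ^ n) := ⟨pow_ne_zero _ hq.ne_zero⟩
    set u := Units.ofPowEqOne _ p h1 hp.ne_zero
    have hu : u ^ p = 1 := by
      ext; simp [u, h1]
    have hd1 := orderOf_dvd_of_pow_eq_one hu
    have hd2 : u ^ (q ^ n).totient = 1 := ZMod.pow_totient u
    have hd2 := orderOf_dvd_of_pow_eq_one hd2
    have hcop : Nat.Coprime p (q ^ n).totient := by
      rw [Nat.Prime.coprime_iff_not_dvd hp]
      intro hd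
      rcases Nat.eq_zero_or_pos n with rfl | hn
      · simp at hd; exact hp.one_lt.ne' hd
      rw [Nat.totient_prime_pow hq hn] at hd
      rcases (Nat.Prime.dvd_mul hp).1 hd with hd | hd
      · have := Nat.le_of_dvd hq.pos (hp.dvd_of_dvd_pow hd); omega
      · have := Nat.le_of_dvd (by have := hq.two_le; omega) hd; omega
    have : orderOf u = 1 := Nat.eq_one_of_dvd_coprimes hcop hd1 hd2
    have := orderOf_eq_one_iff.1 this
    have := congrArg Units.val this
    simpa [u] using this
  have := (ZMod.intCast_zmod_eq_zero_iff_dvd (c - 1) (q ^ n)).1 (by push_cast; rw [h2]; ring)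
  exact_mod_cast this

theorem cas_lower (p q : ℕ) (hp : p.Prime) (hq : q.Prime) (hqp : q < p)
    (hpodd : Odd p) (hqodd : Odd q) (ε : ℤ) (hε : ε = 1 ∨ ε = -1)
    (x y : ℤ) (hx : 0 < x) (hy : 0 < y) (h : x ^ p - y ^ q = ε) :
    (q : ℤ) ^ (p - 1) + q ≤ x := by
  have hε' : -ε = 1 ∨ -ε = -1 := by rcases hε with rfl | rfl <;> simp
  have h' : y ^ q - x ^ p = -ε := by linarith
  have hqx : (q : ℤ) ∣ x := by
    by_contra hn
    obtain ⟨a, ha, hxa⟩ := cas_root q p hq hp hqodd hpodd (-ε) hε' y x hy hx h' hn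
    exact cas_easy q p hq.two_le hqp.le (-ε) hε' y x a hy hx h' ha hxa
  obtain ⟨b, c, hb, hc, -, -, h1, h2, h3⟩ :=
    cas_struct q p hq hp hqodd hpodd (-ε) hε' y x hy hx h' hqx
  have hd := cas_dpos q p hq.ne_zero hp.ne_zero (-ε) hε' y x hy hx h'
  obtain ⟨S, r, w, hS, hS2⟩ := cas_S q hqodd (-ε) y hε'
  have hSc : S = q * c ^ p := by
    rw [hS] at h3; exact mul_right_cancel₀ hd.ne' h3
  have hq3 : 3 ≤ q := by
    have := hq.two_le
    rcases hqodd with ⟨k, rfl⟩; omega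
  have hq0 : (0 : ℤ) < q := by exact_mod_cast hq.pos
  have e1 : (q : ℤ) ^ (p - 1) = q * q ^ (p - 2) := by
    rw [← pow_succ']; congr 1; omega
  have hdvd : (q : ℤ) ^ (p - 2) ∣ c ^ p - 1 := by
    refine ⟨b ^ p * (q * r + (y - -ε) * w), ?_⟩
    apply mul_left_cancel₀ hq0.ne'
    rw [mul_sub, ← hSc, hS2]
    nth_rw 1 [h2]
    rw [e1]; ring
  have hdc := cas_modone p q hp hq hqp _ c hdvd
  have hc1 : c ≠ 1 := by
    rintro rfl
    rw [one_pow, mul_one] at h3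
    have hy1 : (q : ℤ) ^ 2 ≤ y - -ε := by
      rw [h2]
      have : (1 : ℤ) ≤ b ^ p := by have : 0 < b ^ p := by positivity
                                   omega
      have h4 : (q : ℤ) ^ 2 ≤ q ^ (p - 1) := pow_le_pow_right₀ (by omega) (by omega)
      nlinarith
    have hy2 : (q : ℤ) ^ 2 - 1 ≤ y := by rcases hε with rfl | rfl <;> linarith
    have hq3' : (3 : ℤ) ≤ q := by exact_mod_cast hq3
    have hy3 : 2 * (q : ℤ) + 2 ≤ y := by nlinarith
    have hy4 : y ^ 2 ≤ y ^ q := pow_le_pow_right₀ (by omega) (by omega)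
    rcases hε with rfl | rfl <;> nlinarith
  have hc2 : (q : ℤ) ^ (p - 2) ≤ c - 1 := Int.le_of_dvd (by omega) hdc
  rw [h1, e1]
  have : (q : ℤ) * (q ^ (p - 2) + 1) ≤ q * c := by
    apply mul_le_mul_of_nonneg_left _ hq0.le; linarith
  have : (q : ℤ) * c ≤ q * b * c := by
    have : 0 < (q : ℤ) * c := by positivity
    nlinarith
  linarith

theorem cas_choose (α : ℝ) (k : ℕ) :
    Ring.choose α k * k.factorial = ∏ i ∈ Finset.range k, (α - i) := by
  have h := Ring.descPochhammer_eq_factorial_smul_choose α k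
  rw [nsmul_eq_mul] at h
  rw [mul_comm, ← h, ← Polynomial.aeval_eq_smeval, Polynomial.aeval_def,
    ← Polynomial.eval_map, show algebraMap ℤ ℝ = Int.castRingHom ℝ from rfl, descPochhammer_map]
  exact descPochhammer_eval_eq_prod_range k α

theorem cas_choose_succ (α : ℝ) (k : ℕ) :
    Ring.choose α (k + 1) * (k + 1) = Ring.choose α k * (α - k) := by
  have h1 := cas_choose α k
  have h2 := cas_choose α (k + 1)
  rw [Finset.prod_range_succ, ← h1, Nat.factorial_succ] at h2
  have : (k.factorial : ℝ) ≠ 0 := by positivity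
  apply mul_right_cancel₀ this
  push_cast at h2
  linarith

theorem cas_choose_le (α : ℝ) (m : ℕ) (h1 : (m : ℝ) - 1 ≤ α) (h2 : α ≤ m) (k : ℕ) (hk : k ≤ m) :
    |Ring.choose α k| ≤ m.choose k := by
  induction k with
  | zero => simp
  | succ k ih =>
    have ih := ih (by omega)
    have e1 := cas_choose_succ α k
    have e2 := Nat.choose_succ_right_eq m k
    have e2 : (m.choose (k+1) : ℝ) * (k + 1) = m.choose k * (m - k) := by
      have : ((m - k : ℕ) : ℝ) = m - k := by rw [Nat.cast_sub (by omega)]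
      rw [← this]; exact_mod_cast e2
    have hk' : (k : ℝ) + 1 ≤ m := by exact_mod_cast hk
    have h3 : |α - k| ≤ m - k := by rw [abs_le]; constructor <;> linarith
    have hpos : (0 : ℝ) < k + 1 := by positivity
    have : |Ring.choose α (k+1)| * (k + 1) ≤ m.choose (k+1) * (k + 1) := by
      rw [e2, ← abs_of_pos hpos, ← abs_mul, e1, abs_mul]
      gcongr
    exact le_of_mul_le_mul_right this hpos

theorem cas_choose_tail (α : ℝ) (m : ℕ) (h1 : (m : ℝ) - 1 ≤ α) (h2 : α ≤ m) (j : ℕ) :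
    |Ring.choose α (j + (m + 1))| ≤ 1 / (m + 1) := by
  induction j with
  | zero =>
    have := cas_choose_le α m h1 h2 m le_rfl
    rw [Nat.choose_self, Nat.cast_one] at this
    have e := cas_choose_succ α m
    have hpos : (0 : ℝ) < m + 1 := by positivity
    rw [zero_add, le_div_iff₀ hpos]
    rw [← abs_of_pos hpos, ← abs_mul, e, abs_mul]
    have h3 : |α - m| ≤ 1 := by rw [abs_le]; constructor <;> linarith
    nlinarith [abs_nonneg (α - m), abs_nonneg (Ring.choose α m)]
  | succ j ih =>
    refine le_trans ?_ ih
    have e := cas_choose_succ α (j + (m + 1))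
    push_cast at e
    have hpos : (0 : ℝ) < (j + (m + 1)) + 1 := by positivity
    rw [show j + 1 + (m + 1) = j + (m + 1) + 1 by ring]
    refine le_of_mul_le_mul_right ?_ hpos
    nth_rw 1 [← abs_of_pos hpos]
    rw [← abs_mul, e, abs_mul]
    have hj : (0 : ℝ) ≤ j := by positivity
    have hm : (0 : ℝ) ≤ m := by positivity
    gcongr
    rw [abs_le]; constructor <;> linarith

theorem cas_taylor (α : ℝ) (m : ℕ) (h1 : (m : ℝ) - 1 ≤ α) (h2 : α ≤ m) (s : ℝ) (hs : |s| < 1) :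
    |(1 + s) ^ α - ∑ k ∈ Finset.range (m + 1), Ring.choose α k * s ^ k| ≤
      1 / (m + 1) * |s| ^ (m + 1) / (1 - |s|) := by
  have h := (Real.one_add_rpow_hasFPowerSeriesOnBall_zero (a := α)).hasSum (y := s) (by
    simpa [enorm_eq_nnnorm, ← NNReal.coe_lt_coe] using hs)
  simp only [binomialSeries_apply, zero_add, List.ofFn_const, List.prod_replicate, smul_eq_mul] at h
  have h3 := (hasSum_nat_add_iff' (m + 1)).2 h
  have hg := (hasSum_geometric_of_lt_one (abs_nonneg s) hs).mul_left (1 / (m + 1) * |s| ^ (m + 1))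
  rw [← div_eq_mul_inv] at hg
  refine HasSum.norm_le_of_bounded h3 hg ?_
  intro i
  rw [Real.norm_eq_abs, abs_mul, abs_pow, pow_add, mul_assoc, mul_comm (|s| ^ i)]
  gcongr
  exact cas_choose_tail α m h1 h2 i

theorem cas_dvd (p q k e n : ℕ) (hk : k.factorial = q ^ e * n) (hn : Nat.Coprime q n) :
    (n : ℤ) ∣ ∏ i ∈ Finset.range k, ((p : ℤ) - i * q) := by
  have hn0 : n ≠ 0 := by
    rintro rfl; exact k.factorial_ne_zero (by simpa using hk)
  have : NeZero n := ⟨hn0⟩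
  rw [← ZMod.intCast_zmod_eq_zero_iff_dvd]
  push_cast
  set s : ℕ := ((p : ZMod n) * (q : ZMod n)⁻¹).val
  have hs : (s : ZMod n) = (p : ZMod n) * (q : ZMod n)⁻¹ := by simp [s]
  have hq : (q : ZMod n) * (q : ZMod n)⁻¹ = 1 := ZMod.coe_mul_inv_eq_one q hn
  have e1 : ∀ i ∈ Finset.range k, ((p : ZMod n) - i * q) = q * ((s : ZMod n) - i) := by
    intro i _
    rw [hs]; linear_combination (-(p : ZMod n)) * hq
  rw [Finset.prod_congr rfl e1, Finset.prod_mul_distrib]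
  rw [← descPochhammer_eval_eq_prod_range k (s : ZMod n), descPochhammer_eval_eq_descFactorial]
  have : n ∣ s.descFactorial k :=
    (Dvd.intro_left _ hk.symm).trans (Nat.factorial_dvd_descFactorial s k)
  rw [(ZMod.natCast_eq_zero_iff _ _).2 this, mul_zero]

theorem cas_int (p q : ℕ) (hp : p.Prime) (hq : q.Prime) (hpq : q ≠ p) (m k : ℕ) (hk : k ≤ m) :
    ∃ N : ℤ, (q : ℝ) ^ (m + m.factorial.factorization q) * Ring.choose ((p : ℝ) / q) k = N ∧
      (k < m → (q : ℤ) ∣ N) ∧ (k = m → ¬ (q : ℤ) ∣ N) := by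
  set e := k.factorial.factorization q
  set f := m.factorial.factorization q
  have hef : e ≤ f :=
    (Nat.factorization_le_iff_dvd (Nat.factorial_ne_zero _) (Nat.factorial_ne_zero _)).2
      (Nat.factorial_dvd_factorial hk) q
  set n := k.factorial / q ^ e
  have hkn : k.factorial = q ^ e * n := (Nat.ordProj_mul_ordCompl_eq_self _ q).symm
  have hcop : Nat.Coprime q n := Nat.coprime_ordCompl hq (Nat.factorial_ne_zero _)
  obtain ⟨R, hR⟩ := cas_dvd p q k e n hkn hcop
  have hqR : (q : ℝ) ≠ 0 := by exact_mod_cast hq.ne_zero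
  have hn0 : (n : ℝ) ≠ 0 := by
    have : n ≠ 0 := by
      intro h0; rw [h0] at hkn; exact k.factorial_ne_zero (by simpa using hkn)
    exact_mod_cast this
  have hc := cas_choose ((p : ℝ) / q) k
  have h1 : Ring.choose ((p : ℝ) / q) k * (q ^ e * n) * q ^ k = n * R := by
    have e1 : ((k.factorial : ℕ) : ℝ) = q ^ e * n := by rw [hkn]; push_cast; rfl
    rw [← e1, hc]
    have e2 : (∏ i ∈ Finset.range k, ((p : ℝ) - i * q)) = n * R := by exact_mod_cast hR
    rw [← e2, show (q : ℝ) ^ k = ∏ i ∈ Finset.range k, (q : ℝ) by simp, ← Finset.prod_mul_distrib]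
    apply Finset.prod_congr rfl
    intro i _
    field_simp
  have h2 : Ring.choose ((p : ℝ) / q) k * q ^ (e + k) = R := by
    apply mul_left_cancel₀ hn0
    rw [← h1, pow_add]; ring
  refine ⟨q ^ ((m - k) + (f - e)) * R, ?_, ?_, ?_⟩
  · push_cast
    rw [← h2]
    rw [show m + f = ((m - k) + (f - e)) + (e + k) by omega, pow_add _ _ (e + k)]
    ring
  · intro hlt
    exact Dvd.dvd.mul_right (dvd_pow_self _ (by omega)) _
  · rintro rfl
    have : f = e := rfl
    simp only [this, le_refl, tsub_self, add_zero, pow_zero, one_mul]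
    intro hdvd
    have hqq : Prime (q : ℤ) := Nat.prime_iff_prime_int.mp hq
    have : (q : ℤ) ∣ ∏ i ∈ Finset.range k, ((p : ℤ) - i * q) := by
      rw [hR]; exact Dvd.dvd.mul_left hdvd _
    obtain ⟨i, _, hi⟩ := (Prime.dvd_finsetProd_iff hqq _).1 this
    have : (q : ℤ) ∣ p := by
      have := dvd_add hi (Dvd.intro_left (i : ℤ) rfl : (q : ℤ) ∣ i * q)
      simpa using this
    have : q ∣ p := by exact_mod_cast this
    exact hpq ((Nat.prime_dvd_prime_iff_eq hq hp).1 this)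

theorem cas_root_close (r y : ℝ) (hr : 0 < r) (hy : 0 < y) (q : ℕ) (hq : 0 < q) :
    |r - y| * y ^ (q - 1) ≤ |r ^ q - y ^ q| := by
  rw [← geom_sum₂_mul, abs_mul, mul_comm]
  gcongr
  refine le_trans ?_ (le_abs_self _)
  have := Finset.single_le_sum (f := fun i => r ^ i * y ^ (q - 1 - i)) (s := Finset.range q)
    (fun i _ => by positivity) (Finset.mem_range.2 hq)
  simpa using this

theorem cas_exp (p q : ℕ) (hp : p.Prime) (hq : q.Prime) (hq3 : 3 ≤ q) (hqp : q < p) :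
    (p / q + 1) + (p / q + 1).factorial.factorization q ≤ p - 1 := by
  have : Fact q.Prime := ⟨hq⟩
  have h1 := sub_one_mul_padicValNat_factorial_lt_of_ne_zero q (n := p / q + 1) (Nat.succ_ne_zero _)
  rw [Nat.factorization_def _ hq]
  set e := padicValNat q (p / q + 1).factorial
  have h2 : 2 * e ≤ (q - 1) * e := Nat.mul_le_mul_right e (by omega)
  have h3 : 3 * (p / q) ≤ q * (p / q) := Nat.mul_le_mul_right _ hq3
  have h4 : q * (p / q) ≤ p := Nat.mul_div_le p q
  have h5 : q * (p / q) ≠ p := by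
    intro h
    have : q ∣ p := ⟨_, h.symm⟩
    have := (Nat.prime_dvd_prime_iff_eq hq hp).1 this
    omega
  omega

theorem cas_aux1 (D x : ℝ) (hD : 0 < D) (hx : D + 3 ≤ x) :
    D * ((x + 1) / (4 * x ^ 2)) ≤ 1 / 4 := by
  have : 0 < x := by linarith
  rw [mul_div_assoc', div_le_div_iff₀ (by positivity) (by norm_num)]
  nlinarith

theorem cas_aux2 (D z : ℝ) (hD : 0 < D) (hx : D + 2 ≤ z) :
    D * (1 / (3 * (z - 1))) ≤ 1 / 3 := by
  rw [mul_div_assoc', div_le_div_iff₀ (by linarith) (by norm_num)]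
  linarith

set_option maxHeartbeats 1000000 in
theorem cas_hard (p q : ℕ) (hp : p.Prime) (hq : q.Prime) (hqp : q < p)
    (hpodd : Odd p) (hqodd : Odd q) (ε : ℤ) (hε : ε = 1 ∨ ε = -1)
    (x y a : ℤ) (hx : 0 < x) (hy : 0 < y) (h : x ^ p - y ^ q = ε) (ha : 0 < a)
    (hxa : x - ε = a ^ q) : False := by
  have hlow := cas_lower p q hp hq hqp hpodd hqodd ε hε x y hx hy h
  have hq3 : 3 ≤ q := by
    have := hq.two_le
    rcases hqodd with ⟨k, rfl⟩; omega
  have hq3' : (3 : ℤ) ≤ q := by exact_mod_cast hq3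
  have hexp := cas_exp p q hp hq hq3 hqp
  set m := p / q + 1 with hm
  set f := m.factorial.factorization q with hf
  have hm2 : 2 ≤ m := by
    have : 1 ≤ p / q := (Nat.one_le_div_iff hq.pos).2 hqp.le
    omega
  have hmod : q * (p / q) + p % q = p := Nat.div_add_mod p q
  have hmod0 : p % q ≠ 0 := by
    intro h0
    have := (Nat.prime_dvd_prime_iff_eq hq hp).1 (Nat.dvd_of_mod_eq_zero h0)
    omega
  have hmodlt : p % q < q := Nat.mod_lt _ hq.pos
  have hmq : m * q = q * (p / q) + q := by rw [hm]; ring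
  have hmqp : p ≤ m * q := by omega
  have hmqp2 : m * q - p ≤ q - 1 := by omega
  clear_value m
  -- a ≥ 4
  have ha4 : 4 ≤ a := by
    have h1 : (q : ℤ) ^ q < a ^ q := by
      have : (q : ℤ) ^ q ≤ q ^ (p - 1) := pow_le_pow_right₀ (by omega) (by omega)
      rw [← hxa]; rcases hε with rfl | rfl <;> linarith
    have := lt_of_pow_lt_pow_left₀ q ha.le h1
    omega
  -- y ≥ x
  have hyx : x ≤ y := by
    have h1 : x ^ (q + 1) ≤ x ^ p := pow_le_pow_right₀ (by omega) (by omega)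
    have hx3 : 3 ≤ x := by have : 0 < (q : ℤ) ^ (p - 1) := by positivity
                           omega
    have h2 : 0 < x ^ q := by positivity
    rw [pow_succ] at h1
    have h3 : x ^ q ≤ y ^ q := by rcases hε with rfl | rfl <;> nlinarith
    exact le_of_pow_le_pow_left₀ hq.ne_zero hy.le h3
  have hy2 : x ^ 2 ≤ y ^ (q - 1) :=
    (pow_le_pow_left₀ hx.le hyx 2).trans (pow_le_pow_right₀ (by omega) (by omega))
  have ha1 : 4 * a ^ (m * q - p) ≤ x + 1 := by
    have h1 : a ^ (m * q - p) ≤ a ^ (q - 1) := pow_le_pow_right₀ (by omega) hmqp2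
    have h2 : a * a ^ (q - 1) = a ^ q := mul_pow_sub_one hq.ne_zero a
    have h3 : 0 < a ^ (q - 1) := by positivity
    rcases hε with rfl | rfl <;> nlinarith
  -- the integers
  choose! N hN1 hN2 hN3 using fun k (hk : k ≤ m) => cas_int p q hp hq hqp.ne m k hk
  set W : ℤ := q ^ (m + f) * a ^ (m * q - p) * y -
    ∑ k ∈ Finset.range (m + 1), N k * ε ^ k * (a ^ q) ^ (m - k) with hW
  have hWq : ¬ (q : ℤ) ∣ W := by
    intro hd
    rw [hW, Finset.sum_range_succ] at hd
    have h1 : (q : ℤ) ∣ q ^ (m + f) * a ^ (m * q - p) * y :=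
      Dvd.dvd.mul_right (Dvd.dvd.mul_right (dvd_pow_self _ (by omega)) _) _
    have h2 : (q : ℤ) ∣ ∑ k ∈ Finset.range m, N k * ε ^ k * (a ^ q) ^ (m - k) := by
      apply Finset.dvd_sum
      intro k hk
      have hk := Finset.mem_range.1 hk
      exact Dvd.dvd.mul_right (Dvd.dvd.mul_right (hN2 k hk.le hk) _) _
    have h3 : (q : ℤ) ∣ N m * ε ^ m := by
      have := dvd_sub (dvd_sub h1 h2) hd
      simpa using this
    have hqq : Prime (q : ℤ) := Nat.prime_iff_prime_int.mp hq
    rcases hqq.dvd_or_dvd h3 with h4 | h4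
    · exact hN3 m le_rfl rfl h4
    · have := hqq.dvd_of_dvd_pow h4
      have : IsUnit ε := by rcases hε with rfl | rfl <;> simp
      exact hqq.not_isUnit (isUnit_of_dvd_unit ‹_› this)
  have hW0 : W ≠ 0 := by intro h0; rw [h0] at hWq; exact hWq (dvd_zero _)
  -- real estimates
  have hqR : (0 : ℝ) < q := by exact_mod_cast hq.pos
  have haR : (0 : ℝ) < a := by exact_mod_cast ha
  have hxR : (0 : ℝ) < x := by exact_mod_cast hx
  have hyR : (0 : ℝ) < y := by exact_mod_cast hy
  set D : ℝ := (q : ℝ) ^ (m + f) with hD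
  have hDpos : 0 < D := by positivity
  have hDx : D + 3 ≤ x := by
    have h1 : (q : ℝ) ^ (m + f) ≤ q ^ (p - 1) :=
      pow_le_pow_right₀ (by exact_mod_cast hq.one_lt.le) hexp
    have h2 : (q : ℝ) ^ (p - 1) + q ≤ x := by exact_mod_cast hlow
    have h3 : (3 : ℝ) ≤ q := by exact_mod_cast hq3
    linarith
  set α : ℝ := (p : ℝ) / q with hα
  have hαm : α ≤ m := by
    rw [hα, div_le_iff₀ hqR]; exact_mod_cast hmqp
  have hαm' : (m : ℝ) - 1 ≤ α := by
    rw [hα, le_div_iff₀ hqR, hm]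
    push_cast
    rw [add_sub_cancel_right]
    have : p / q * q ≤ p := Nat.div_mul_le_self p q
    exact_mod_cast this
  have hεabs : |(ε : ℝ)| = 1 := by rcases hε with rfl | rfl <;> simp
  set s : ℝ := ε / (a : ℝ) ^ q with hs
  have haq : (0 : ℝ) < (a : ℝ) ^ q := by positivity
  have hxaR : (x : ℝ) - ε = (a : ℝ) ^ q := by exact_mod_cast hxa
  have hεle : (ε : ℝ) ≤ 1 := by rw [← hεabs]; exact le_abs_self _
  have haq2 : D + 2 ≤ (a : ℝ) ^ q := by rw [← hxaR]; linarith
  have hsabs : |s| = 1 / (a : ℝ) ^ q := by rw [hs, abs_div, hεabs, abs_of_pos haq]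
  have hs1 : |s| < 1 := by rw [hsabs, div_lt_one haq]; linarith
  have htay := cas_taylor α m hαm' hαm s hs1
  set T := ∑ k ∈ Finset.range (m + 1), Ring.choose α k * s ^ k with hT
  set r : ℝ := (x : ℝ) ^ α with hr
  have hrpos : 0 < r := by positivity
  have hrq : r ^ q = (x : ℝ) ^ p := by
    rw [hr, ← Real.rpow_natCast, ← Real.rpow_mul hxR.le, hα, div_mul_cancel₀ _ hqR.ne',
      Real.rpow_natCast]
  have hrs : r = (a : ℝ) ^ p * (1 + s) ^ α := by
    have e1 : (x : ℝ) = (a : ℝ) ^ q * (1 + s) := by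
      rw [hs]; field_simp; linarith
    have hs0 : 0 ≤ 1 + s := by linarith [neg_abs_le s]
    rw [hr, e1, Real.mul_rpow haq.le hs0, ← Real.rpow_natCast (a : ℝ) q, ← Real.rpow_mul haR.le,
      hα, mul_div_cancel₀ _ hqR.ne', Real.rpow_natCast]
  have hWeq : (W : ℝ) = D * ((a : ℝ) ^ (m * q - p) * (y - r) +
      ((a : ℝ) ^ q) ^ m * ((1 + s) ^ α - T)) := by
    have e1 : ((a : ℝ) ^ q) ^ m * (1 + s) ^ α = (a : ℝ) ^ (m * q - p) * r := by
      rw [hrs, ← mul_assoc, ← pow_add, ← pow_mul]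
      congr 2
      rw [mul_comm q m]; omega
    have e2 : D * (((a : ℝ) ^ q) ^ m * T) =
        ∑ k ∈ Finset.range (m + 1), (N k : ℝ) * ε ^ k * ((a : ℝ) ^ q) ^ (m - k) := by
      rw [hT, Finset.mul_sum, Finset.mul_sum]
      apply Finset.sum_congr rfl
      intro k hk
      have hk : k ≤ m := by have := Finset.mem_range.1 hk; omega
      rw [← hN1 k hk, hs, div_pow, pow_sub₀ _ haq.ne' hk]
      field_simp
    rw [mul_add, mul_sub, mul_sub, mul_sub, e1, mul_sub, e2, hW]
    push_cast
    ring
  have hE1 : |(a : ℝ) ^ (m * q - p) * (y - r)| ≤ (x + 1) / (4 * (x : ℝ) ^ 2) := by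
    have h1 := cas_root_close r y hrpos hyR q hq.pos
    have h2 : r ^ q - (y : ℝ) ^ q = ε := by rw [hrq]; exact_mod_cast h
    rw [h2, hεabs] at h1
    have h3 : (x : ℝ) ^ 2 ≤ (y : ℝ) ^ (q - 1) := by exact_mod_cast hy2
    have h4 : 4 * (a : ℝ) ^ (m * q - p) ≤ x + 1 := by exact_mod_cast ha1
    have h5 : |r - y| * (x : ℝ) ^ 2 ≤ 1 :=
      (mul_le_mul_of_nonneg_left h3 (abs_nonneg _)).trans h1
    rw [abs_mul, abs_sub_comm, abs_of_pos (by positivity), le_div_iff₀ (by positivity)]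
    calc (a : ℝ) ^ (m * q - p) * |r - y| * (4 * (x : ℝ) ^ 2)
        = (4 * (a : ℝ) ^ (m * q - p)) * (|r - y| * (x : ℝ) ^ 2) := by ring
      _ ≤ ((x : ℝ) + 1) * 1 := by gcongr
      _ = (x : ℝ) + 1 := by ring
  have hE2 : |((a : ℝ) ^ q) ^ m * ((1 + s) ^ α - T)| ≤ 1 / (3 * ((a : ℝ) ^ q - 1)) := by
    rw [abs_mul, abs_of_pos (by positivity : 0 < ((a : ℝ) ^ q) ^ m)]
    have hz : 0 < (a : ℝ) ^ q - 1 := by linarith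
    calc _ ≤ ((a : ℝ) ^ q) ^ m * (1 / (m + 1) * |s| ^ (m + 1) / (1 - |s|)) := by gcongr
      _ = 1 / ((m + 1) * ((a : ℝ) ^ q - 1)) := by
        rw [hsabs]
        have : 1 - 1 / (a : ℝ) ^ q = ((a : ℝ) ^ q - 1) / (a : ℝ) ^ q := by field_simp
        rw [this, div_pow, one_pow, pow_succ]
        field_simp
      _ ≤ _ := by
        gcongr
        have : (2 : ℝ) ≤ m := by exact_mod_cast hm2
        linarith
  have hWlt : |(W : ℝ)| < 1 := by
    rw [hWeq, abs_mul, abs_of_pos hDpos]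
    have h1 : D * ((x + 1) / (4 * (x : ℝ) ^ 2)) ≤ 1 / 4 := by
      exact cas_aux1 D x hDpos hDx
    have h2 : D * (1 / (3 * ((a : ℝ) ^ q - 1))) ≤ 1 / 3 := by
      exact cas_aux2 D _ hDpos haq2
    have h3 := abs_add_le ((a : ℝ) ^ (m * q - p) * (y - r)) (((a : ℝ) ^ q) ^ m * ((1 + s) ^ α - T))
    have h4 := mul_le_mul_of_nonneg_left (h3.trans (add_le_add hE1 hE2)) hDpos.le
    rw [mul_add] at h4
    linarith
  have : |W| < 1 := by exact_mod_cast hWlt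
  exact hW0 (Int.abs_lt_one_iff.1 this)

theorem cas_half (p q : ℕ) (hp : p.Prime) (hq : q.Prime)
    (hpodd : Odd p) (hqodd : Odd q) (ε : ℤ) (hε : ε = 1 ∨ ε = -1)
    (x y : ℤ) (hx : 0 < x) (hy : 0 < y) (h : x ^ p - y ^ q = ε) :
    ∃ u v : ℤ, 0 < u ∧ 0 < v ∧ IsCoprime u v ∧ ¬ (p : ℤ) ∣ v ∧
      y = p * u * v ∧ x - ε = (p : ℤ) ^ (q - 1) * u ^ q ∧
      x ^ p - ε = p * v ^ q * (x - ε) := by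
  apply cas_struct p q hp hq hpodd hqodd ε hε x y hx hy h
  by_contra hn
  obtain ⟨a, ha, hxa⟩ := cas_root p q hp hq hpodd hqodd ε hε x y hx hy h hn
  rcases le_or_gt p q with hle | hlt
  · exact cas_easy p q hp.two_le hle ε hε x y a hx hy h ha hxa
  · exact cas_hard p q hp hq hlt hpodd hqodd ε hε x y a hx hy h ha hxa

/-- The Cassels relations: if `p, q` are odd primes, `ε = ±1`, and `x, y` are positive
integers with `x ^ p - y ^ q = ε`, then
(a) there are coprime positive integers `b, c` with `q ∤ c`, `x = q b c`,
`y + ε = q ^ (p-1) b ^ p` and `y ^ q + ε = q c ^ p (y + ε)`;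
(b) there are coprime positive integers `u, v` with `p ∤ v`, `y = p u v`,
`x - ε = p ^ (q-1) u ^ q` and `x ^ p - ε = p v ^ q (x - ε)`. -/
theorem cassels_relations (p q : ℕ) (hp : p.Prime) (hq : q.Prime)
    (hpodd : Odd p) (hqodd : Odd q) (ε : ℤ) (hε : ε = 1 ∨ ε = -1)
    (x y : ℤ) (hx : 0 < x) (hy : 0 < y) (h : x ^ p - y ^ q = ε) :
    (∃ b c : ℤ, 0 < b ∧ 0 < c ∧ IsCoprime b c ∧ ¬ (q : ℤ) ∣ c ∧
      x = q * b * c ∧ y + ε = (q : ℤ) ^ (p - 1) * b ^ p ∧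
      y ^ q + ε = q * c ^ p * (y + ε)) ∧
    (∃ u v : ℤ, 0 < u ∧ 0 < v ∧ IsCoprime u v ∧ ¬ (p : ℤ) ∣ v ∧
      y = p * u * v ∧ x - ε = (p : ℤ) ^ (q - 1) * u ^ q ∧
      x ^ p - ε = p * v ^ q * (x - ε)) := by
  have hε' : -ε = 1 ∨ -ε = -1 := by rcases hε with rfl | rfl <;> simp
  have h1 := cas_half q p hq hp hqodd hpodd (-ε) hε' y x hy hx (by linarith)
  simp only [sub_neg_eq_add] at h1
  exact ⟨h1, cas_half p q hp hq hpodd hqodd ε hε x y hx hy h⟩
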